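/- Let m ≥ 4, let s be the m-dimensional score vector with s(k) = 1/2 for all k ∈ {2, …, m−1}, and let s' be an m-dimensional score vector with s'(k) = α for all k ∈ {2, …, m−1}, where 0 ≤ α < 1/2. Then there exists a preference profile ≿ on X = {x, y_1, …, y_{m−1}} such that x is a Condorcet loser at ≿, f^s(≿) = {x}, and x ∉ f^{s'}(≿). -/

import Mathlib

open Finset

/-- A preference profile over `m` alternatives with `n` voters: voter `i`'s linear
order `≿_i` is encoded by the bijection `P i` sending each alternative to its
0-indexed rank (rank `0` = first, rank `m-1` = last); thus `y ≿_i x` iff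
`P i y ≤ P i x`, and the 1-indexed rank is `r(x, ≿_i) = (P i x : ℕ) + 1`. -/
abbrev Profile (m n : ℕ) := Fin n → (Fin m ≃ Fin m)

/-- `s` is a score vector for `m` alternatives: entries in `[0,1]`, weakly
decreasing, first entry `1`, last entry `0` (index `k : Fin m` corresponds to
the 1-indexed rank `k + 1`). -/
def IsScoreVec {m : ℕ} (s : Fin m → ℝ) : Prop :=
  Antitone s ∧ (∀ k, 0 ≤ s k ∧ s k ≤ 1) ∧
    (∀ k : Fin m, (k : ℕ) = 0 → s k = 1) ∧
    (∀ k : Fin m, (k : ℕ) = m - 1 → s k = 0)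

/-- The Borda score vector: 1-indexed, `s^B(k) = (m - k)/(m - 1)`, i.e.
0-indexed, `k ↦ (m - 1 - k)/(m - 1)`. -/
noncomputable def bordaVec (m : ℕ) : Fin m → ℝ :=
  fun k => ((m : ℝ) - 1 - (k : ℕ)) / ((m : ℝ) - 1)

/-- Total score `∑_{i ∈ N} s(r(x, ≿_i))` of alternative `x` at profile `P`. -/
noncomputable def score {m n : ℕ} (s : Fin m → ℝ) (P : Profile m n) (x : Fin m) : ℝ :=
  ∑ i, s (P i x)

/-- The choice set `f^s(≿)` of the scoring rule with score vector `s`. -/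
def winners {m n : ℕ} (s : Fin m → ℝ) (P : Profile m n) : Set (Fin m) :=
  {x | ∀ y, score s P y ≤ score s P x}

/-- `x` is a Condorcet loser at `P`: for every `y ≠ x`,
`|{i : y ≿_i x}| > |{i : x ≿_i y}|`. -/
def CondorcetLoser {m n : ℕ} (P : Profile m n) (x : Fin m) : Prop :=
  ∀ y, y ≠ x →
    (univ.filter fun i => P i x ≤ P i y).card <
      (univ.filter fun i => P i y ≤ P i x).card

/-- Three distinct alternatives can be placed first, second to last and last. -/
lemma exists_perm_first_penultimate_last {m : ℕ} (hm : 3 ≤ m) {a b c : Fin m}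
    (hab : a ≠ b) (hac : a ≠ c) (hbc : b ≠ c) :
    ∃ σ : Fin m ≃ Fin m, (σ a : ℕ) = 0 ∧ (σ b : ℕ) = m - 2 ∧ (σ c : ℕ) = m - 1 := by
  have hinj : ∀ {p q r : Fin m}, p ≠ q → p ≠ r → q ≠ r → Function.Injective ![p, q, r] := by
    intro p q r hpq hpr hqr i j hij
    fin_cases i <;> fin_cases j <;> simp_all
  have htarget : Function.Injective
      ![(⟨0, by omega⟩ : Fin m), ⟨m - 2, by omega⟩, ⟨m - 1, by omega⟩] := by
    apply hinj <;> rw [Ne, Fin.mk.injEq] <;> omega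
  obtain ⟨σ, hσ⟩ := (Equiv.Perm.isMultiplyPretransitive (Fin m) 3).exists_smul_eq
    ⟨_, hinj hab hac hbc⟩ ⟨_, htarget⟩
  have hval : ∀ i, σ (![a, b, c] i) =
      ![(⟨0, by omega⟩ : Fin m), ⟨m - 2, by omega⟩, ⟨m - 1, by omega⟩] i :=
    fun i => DFunLike.congr_fun hσ i
  have h0 := hval 0
  have h1 := hval 1
  have h2 := hval 2
  simp only [Matrix.cons_val] at h0 h1 h2
  exact ⟨σ, by simp [h0], by simp [h1], by simp [h2]⟩

/-- A score vector with constant middle entries only sees who is first and who is last. -/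
lemma score_entry_of_flat {m : ℕ} (hm : 2 ≤ m) {t : Fin m → ℝ} (ht : IsScoreVec t) {β : ℝ}
    (hmid : ∀ k : Fin m, 1 ≤ (k : ℕ) → (k : ℕ) ≤ m - 2 → t k = β)
    {σ : Fin m ≃ Fin m} {a c : Fin m} (ha : (σ a : ℕ) = 0) (hc : (σ c : ℕ) = m - 1)
    (y : Fin m) : t (σ y) = if y = a then 1 else if y = c then 0 else β := by
  split_ifs with hya hyc
  · exact ht.2.2.1 _ (hya ▸ ha)
  · exact ht.2.2.2 _ (hyc ▸ hc)
  · have h0 : (σ y : ℕ) ≠ σ a := fun h => hya (σ.injective (Fin.ext h))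
    have h1 : (σ y : ℕ) ≠ σ c := fun h => hyc (σ.injective (Fin.ext h))
    have := (σ y).isLt
    exact hmid _ (by omega) (by omega)

lemma penultimate_le_iff {m : ℕ} (hm : 2 ≤ m) {σ : Fin m ≃ Fin m} {b c : Fin m}
    (hb : (σ b : ℕ) = m - 2) (hc : (σ c : ℕ) = m - 1) {y : Fin m} (hy : y ≠ b) :
    σ b ≤ σ y ↔ y = c := by
  have h0 : (σ y : ℕ) ≠ σ b := fun h => hy (σ.injective (Fin.ext h))
  have := (σ y).isLt
  rw [Fin.le_def, ← σ.injective.eq_iff, Fin.ext_iff]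
  omega

lemma le_penultimate_iff {m : ℕ} (hm : 2 ≤ m) {σ : Fin m ≃ Fin m} {b c : Fin m}
    (hb : (σ b : ℕ) = m - 2) (hc : (σ c : ℕ) = m - 1) (y : Fin m) :
    σ y ≤ σ b ↔ y ≠ c := by
  have := (σ y).isLt
  rw [Fin.le_def, Ne, ← σ.injective.eq_iff, Fin.ext_iff]
  omega

/-- There is a profile of `3 * K + 1` voters where three given ballots occur `K` times each and a
fourth one occurs once. -/
lemma exists_profile_of_ballots {m : ℕ} (K : ℕ) (σ : Fin 3 → (Fin m ≃ Fin m))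
    (τ : Fin m ≃ Fin m) :
    ∃ P : Profile m (3 * K + 1), ∀ {M : Type} [AddCommMonoid M] (g : (Fin m ≃ Fin m) → M),
      ∑ i, g (P i) = g τ + (K • g (σ 0) + K • g (σ 1) + K • g (σ 2)) := by
  have hcard : Fintype.card (Option (Fin 3 × Fin K)) = 3 * K + 1 := by simp
  let e := Fintype.equivFinOfCardEq hcard
  refine ⟨fun i => (e.symm i).elim τ fun p => σ p.1, fun g => ?_⟩
  rw [e.symm.sum_comp fun v => g (v.elim τ fun p => σ p.1)]
  simp [Fintype.sum_option, Fintype.sum_prod_type, Fin.sum_univ_three]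

/-- Exceptional flat case: `s` has all middle entries `1/2`, `s'` has all middle
entries `α`. -/
theorem flat_case_alpha_lt_half
    (m : ℕ) (hm : 4 ≤ m) (α : ℝ) (hα1 : 0 ≤ α) (hα2 : α < 1/2)
    (s s' : Fin m → ℝ) (hs : IsScoreVec s) (hs' : IsScoreVec s')
    (hmid : ∀ k : Fin m, 1 ≤ (k : ℕ) → (k : ℕ) ≤ m - 2 → s k = 1/2)
    (hmid' : ∀ k : Fin m, 1 ≤ (k : ℕ) → (k : ℕ) ≤ m - 2 → s' k = α) :
    ∃ n : ℕ, 0 < n ∧ ∃ P : Profile m n,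
      CondorcetLoser P ⟨0, by omega⟩ ∧
      winners s P = {(⟨0, by omega⟩ : Fin m)} ∧
      (⟨0, by omega⟩ : Fin m) ∉ winners s' P := by
  obtain ⟨N, hN⟩ := exists_nat_gt (1 / (1 - 2 * α))
  obtain ⟨K, hK2, hKN⟩ : ∃ K : ℕ, 2 ≤ K ∧ N ≤ K := ⟨N + 2, by omega, by omega⟩
  have hK : 1 < K * (1 - 2 * α) := by
    rw [← div_lt_iff₀ (by linarith)]
    exact hN.trans_le (by exact_mod_cast hKN)
  generalize hx : (⟨0, by omega⟩ : Fin m) = x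
  obtain ⟨a, ha⟩ : ∃ a : Fin m, a = ⟨1, by omega⟩ := ⟨_, rfl⟩
  obtain ⟨b, hb⟩ : ∃ b : Fin m, b = ⟨2, by omega⟩ := ⟨_, rfl⟩
  obtain ⟨c, hc⟩ : ∃ c : Fin m, c = ⟨3, by omega⟩ := ⟨_, rfl⟩
  have hxa : x ≠ a := by simp [← hx, ha]
  have hxb : x ≠ b := by simp [← hx, hb]
  have hxc : x ≠ c := by simp [← hx, hc]
  have hab : a ≠ b := by simp [ha, hb]
  have hac : a ≠ c := by simp [ha, hc]
  have hbc : b ≠ c := by simp [hb, hc]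
  clear hx ha hb hc
  have hm2 : 2 ≤ m := by omega
  have hm3 : 3 ≤ m := by omega
  obtain ⟨σ₀, h0f, h0p, h0l⟩ := exists_perm_first_penultimate_last hm3 hxa.symm hab hxb
  obtain ⟨σ₁, h1f, h1p, h1l⟩ := exists_perm_first_penultimate_last hm3 hxb.symm hbc hxc
  obtain ⟨σ₂, h2f, h2p, h2l⟩ := exists_perm_first_penultimate_last hm3 hxc.symm hac.symm hxa
  obtain ⟨τ, hτf, -, hτl⟩ := exists_perm_first_penultimate_last hm3 hxa hxb hab
  obtain ⟨P, hP⟩ := exists_profile_of_ballots K ![σ₀, σ₁, σ₂] τ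
  simp only [Matrix.cons_val] at hP
  have hscore : ∀ {t : Fin m → ℝ} {β : ℝ}, IsScoreVec t →
      (∀ k : Fin m, 1 ≤ (k : ℕ) → (k : ℕ) ≤ m - 2 → t k = β) → ∀ y, score t P y =
        (if y = x then 1 else if y = b then 0 else β) +
          (K * (if y = a then 1 else if y = b then 0 else β) +
           K * (if y = b then 1 else if y = c then 0 else β) +
           K * (if y = c then 1 else if y = a then 0 else β)) := by
    intro t β ht hβ y
    rw [score, hP fun σ => t (σ y), score_entry_of_flat hm2 ht hβ hτf hτl,
      score_entry_of_flat hm2 ht hβ h0f h0l, score_entry_of_flat hm2 ht hβ h1f h1l,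
      score_entry_of_flat hm2 ht hβ h2f h2l]
    simp only [nsmul_eq_mul]
  have hlt : ∀ y, y ≠ x → score s P y < score s P x := by
    intro y hy
    rw [hscore hs hmid, hscore hs hmid]
    by_cases hya : y = a
    · subst hya; simp [*]; linarith
    by_cases hyb : y = b
    · subst hyb; simp [*, hab.symm]; linarith
    by_cases hyc : y = c
    · subst hyc; simp [*, hac.symm, hbc.symm]; linarith
    simp [*]; linarith
  refine ⟨3 * K + 1, by omega, P, ?_, ?_, ?_⟩
  · intro y hy
    have hτ : ¬ τ y ≤ τ x := by
      intro h
      have : (τ y : ℕ) = τ x := by have := Fin.le_def.1 h; omega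
      exact hy (τ.injective (Fin.ext this))
    rw [card_filter, card_filter, hP fun σ => if σ x ≤ σ y then 1 else 0,
      hP fun σ => if σ y ≤ σ x then 1 else 0]
    simp only [penultimate_le_iff hm2 h0p h0l hy, penultimate_le_iff hm2 h1p h1l hy,
      penultimate_le_iff hm2 h2p h2l hy, le_penultimate_iff hm2 h0p h0l,
      le_penultimate_iff hm2 h1p h1l, le_penultimate_iff hm2 h2p h2l, hτ,
      (not_le.1 hτ).le, if_true, if_false, smul_eq_mul]
    by_cases hya : y = a
    · subst hya; simp [*]; omega
    by_cases hyb : y = b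
    · subst hyb; simp [*]; omega
    by_cases hyc : y = c
    · subst hyc; simp [*, hac.symm, hbc.symm]; omega
    simp [*]; omega
  · ext y
    rw [Set.mem_singleton_iff]
    constructor
    · intro h
      by_contra hy
      exact (h x).not_gt (hlt y hy)
    · rintro rfl z
      by_cases hz : z = y
      · rw [hz]
      · exact (hlt z hz).le
  · intro h
    have := h a
    rw [hscore hs' hmid', hscore hs' hmid'] at this
    simp only [hxa, hxb, hxc, hab, hac, hxa.symm, if_true, if_false] at this
    linarith
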